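/- For n ≥ k ≥ 0, the number of n-restricted set partitions of {1,...,n+k} equals the sum over partitions λ of integers i with 0 ≤ i ≤ k of ∑_{r=i}^{k} C(n,i)·C(k,r)·S(r,i)·B(k-r)·(f^λ)², where S(r,i) is the Stirling number of the second kind, B is the Bell number, and f^λ is the number of standard Young tableaux of shape λ. -/

import Mathlib

/-- The Bell number `B m`. -/
noncomputable def bell (m : ℕ) : ℕ := Nat.card (Setoid (Fin m))

/-- The Stirling number of the second kind `S(r,i)`: the number of set
partitions of an `r`-element set into exactly `i` parts. -/
noncomputable def stirling (r i : ℕ) : ℕ :=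
  Nat.card {P : Setoid (Fin r) // Nat.card (Quotient P) = i}

/-- The cells of the Young diagram whose parts (row lengths) are given by the
multiset `M`: `(r,c)` is a cell iff the number of parts exceeding `c` is
greater than `r`. -/
def cells (M : Multiset ℕ) : Set (ℕ × ℕ) :=
  {p | p.1 < (M.filter (fun x => p.2 < x)).card}

/-- `fSYT i M` is the number of standard Young tableaux of the shape with `i`
boxes and row lengths `M`: bijective fillings of the cells by `{0,…,i-1}`
increasing along rows and columns. -/
noncomputable def fSYT (i : ℕ) (M : Multiset ℕ) : ℕ :=
  Nat.card {F : ℕ × ℕ → ℕ //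
    (∀ p, p ∉ cells M → F p = 0) ∧
    Set.BijOn F (cells M) (Set.Iio i) ∧
    (∀ r c, (r, c + 1) ∈ cells M → F (r, c) < F (r, c + 1)) ∧
    (∀ r c, (r + 1, c) ∈ cells M → F (r, c) < F (r + 1, c))}

/-- A set partition of `{1,…,n+k}` is `n`-restricted if the first `n`
elements lie in pairwise distinct parts. -/
def Restricted (n k : ℕ) (P : Setoid (Fin (n + k))) : Prop :=
  ∀ a b : Fin n, P.r (Fin.castAdd k a) (Fin.castAdd k b) → a = b

section Tableaux

open Finset

/-- `F` is a standard filling of the cells in `s` by `{0,…,i-1}`, extended by zero. -/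
def IsStandardFilling (i : ℕ) (s : Set (ℕ × ℕ)) (F : ℕ × ℕ → ℕ) : Prop :=
  (∀ p, p ∉ s → F p = 0) ∧
    Set.BijOn F s (Set.Iio i) ∧
    (∀ r c, (r, c + 1) ∈ s → F (r, c) < F (r, c + 1)) ∧
    (∀ r c, (r + 1, c) ∈ s → F (r, c) < F (r + 1, c))

namespace YoungDiagram

/-- The number of standard Young tableaux of shape `μ`. -/
noncomputable def numTableaux (μ : YoungDiagram) : ℕ :=
  Nat.card {F // IsStandardFilling μ.card (μ : Set (ℕ × ℕ)) F}

theorem sum_rowLens (μ : YoungDiagram) : μ.rowLens.sum = μ.card := by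
  have h : ∀ c ∈ μ.cells, c.1 ∈ range (μ.colLen 0) := by
    rintro ⟨i, j⟩ hc
    rw [mem_range, ← mem_iff_lt_colLen]
    exact μ.up_left_mem le_rfl (Nat.zero_le j) hc
  rw [YoungDiagram.card, card_eq_sum_card_fiberwise h, rowLens,
    ← List.sum_toFinset _ List.nodup_range, List.toFinset_range]
  exact sum_congr rfl fun i _ => rowLen_eq_card μ

theorem cells_rowLens (μ : YoungDiagram) :
    _root_.cells (μ.rowLens : Multiset ℕ) = (μ : Set (ℕ × ℕ)) := by
  ext ⟨r, c⟩
  have h : ((List.range (μ.colLen 0)).map μ.rowLen).countP (fun x => decide (c < x))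
      = μ.colLen c := by
    rw [List.countP_map, List.countP_eq_length_filter,
      ← List.toFinset_card_of_nodup (List.nodup_range.filter _), List.toFinset_filter,
      List.toFinset_range, ← card_range (μ.colLen c)]
    congr 1
    ext i
    simp only [Function.comp_apply, mem_filter, mem_range, decide_eq_true_eq,
      ← mem_iff_lt_rowLen, ← mem_iff_lt_colLen]
    exact ⟨fun h => h.2, fun h => ⟨μ.up_left_mem le_rfl (Nat.zero_le c) h, h⟩⟩
  simp only [_root_.cells, Set.mem_ofPred_eq, Multiset.filter_coe, Multiset.coe_card, SetLike.mem_coe]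
  rw [← List.countP_eq_length_filter, rowLens, h, mem_iff_lt_colLen]

/-- The Young diagram whose row lengths are the parts of `p`. -/
def ofPartition {n : ℕ} (p : n.Partition) : YoungDiagram :=
  ofRowLens (p.parts.sort (· ≥ ·)) (p.parts.pairwise_sort (· ≥ ·)).sortedGE

theorem rowLens_ofPartition {n : ℕ} (p : n.Partition) :
    ((ofPartition p).rowLens : Multiset ℕ) = p.parts := by
  rw [ofPartition, rowLens_ofRowLens_eq_self, Multiset.sort_eq]
  intro x hx
  exact p.parts_pos ((Multiset.mem_sort _).1 hx)

theorem card_ofPartition {n : ℕ} (p : n.Partition) : (ofPartition p).card = n := by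
  rw [← sum_rowLens, ← Multiset.sum_coe, rowLens_ofPartition, p.parts_sum]

theorem ofPartition_injective {n : ℕ} :
    Function.Injective (ofPartition : n.Partition → YoungDiagram) := by
  intro p q h
  ext1
  rw [← rowLens_ofPartition p, h, rowLens_ofPartition]

theorem exists_ofPartition_eq (μ : YoungDiagram) : ∃ p : μ.card.Partition, ofPartition p = μ := by
  let p : μ.card.Partition :=
    ⟨μ.rowLens, fun h => μ.pos_of_mem_rowLens _ h, by rw [Multiset.sum_coe, sum_rowLens]⟩
  refine ⟨p, equivListRowLens.injective (Subtype.ext ?_)⟩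
  exact (Multiset.coe_eq_coe.1 (rowLens_ofPartition p)).eq_of_sortedGE
    (rowLens_sorted _) (rowLens_sorted _)

theorem fSYT_parts {n : ℕ} (p : n.Partition) : fSYT n p.parts = (ofPartition p).numTableaux := by
  rw [numTableaux, card_ofPartition, ← cells_rowLens, rowLens_ofPartition]
  rfl

/-- The Young diagrams with `n` cells. -/
def diagrams (n : ℕ) : Finset YoungDiagram :=
  univ.map ⟨ofPartition (n := n), ofPartition_injective⟩

theorem mem_diagrams {n : ℕ} {μ : YoungDiagram} : μ ∈ diagrams n ↔ μ.card = n := by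
  simp only [diagrams, mem_map, mem_univ, true_and, Function.Embedding.coeFn_mk]
  refine ⟨?_, ?_⟩
  · rintro ⟨p, rfl⟩
    exact card_ofPartition p
  · rintro rfl
    exact exists_ofPartition_eq μ

theorem _root_.IsStandardFilling.le {i : ℕ} {μ : YoungDiagram} {F : ℕ × ℕ → ℕ}
    (hF : IsStandardFilling i (μ : Set (ℕ × ℕ)) F) {p q : ℕ × ℕ} (hpq : p ≤ q) (hq : q ∈ μ) :
    F p ≤ F q := by
  obtain ⟨r, c⟩ := p
  obtain ⟨r', c'⟩ := q
  obtain ⟨hr, hc⟩ := Prod.mk_le_mk.1 hpq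
  obtain ⟨a, rfl⟩ := Nat.exists_eq_add_of_le hr
  obtain ⟨b, rfl⟩ := Nat.exists_eq_add_of_le hc
  clear hpq hr hc
  induction a with
  | zero =>
    induction b with
    | zero => exact le_rfl
    | succ b ih =>
      exact (ih (μ.up_left_mem le_rfl (Nat.le_succ _) hq)).trans (hF.2.2.1 _ _ hq).le
  | succ a ih =>
    exact (ih (μ.up_left_mem (Nat.le_succ _) le_rfl hq)).trans (hF.2.2.2 _ _ hq).le

theorem _root_.IsStandardFilling.ext {i : ℕ} {s : Set (ℕ × ℕ)} {F G : ℕ × ℕ → ℕ}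
    (hF : IsStandardFilling i s F) (hG : IsStandardFilling i s G)
    (h : ∀ p ∈ s, F p = G p) : F = G := by
  funext p
  by_cases hp : p ∈ s
  · exact h p hp
  · rw [hF.1 p hp, hG.1 p hp]

instance finite_fillings (i : ℕ) (μ : YoungDiagram) :
    Finite {F // IsStandardFilling i (μ : Set (ℕ × ℕ)) F} := by
  refine Finite.of_injective
    (fun F (p : μ.cells) => (⟨F.1 p, F.2.2.1.mapsTo p.2⟩ : Set.Iio i)) fun F G h => ?_
  refine Subtype.ext (F.2.ext G.2 fun p hp => ?_)
  exact congrArg Subtype.val (congrFun h ⟨p, hp⟩)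

theorem exists_mem_notMem_iff {μ ν : YoungDiagram} (h : μ.card = ν.card + 1) (hle : ν ≤ μ) :
    ∃ x, ∀ p, (p ∈ μ ∧ p ∉ ν) ↔ p = x := by
  obtain ⟨x, hx⟩ : ∃ x, μ.cells \ ν.cells = {x} := by
    rw [← Finset.card_eq_one, card_sdiff_of_subset (cells_subset_iff.2 hle)]
    exact (by omega : μ.card - ν.card = 1)
  refine ⟨x, fun p => ?_⟩
  rw [← mem_singleton, ← hx, mem_sdiff, mem_cells, mem_cells]

/-- Extend a filling of `ν` by the value `n` on the cells of `μ` outside `ν`. -/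
def extendFilling (n : ℕ) (μ ν : YoungDiagram) (F : ℕ × ℕ → ℕ) (p : ℕ × ℕ) : ℕ :=
  if p ∈ μ ∧ p ∉ ν then n else F p

theorem isStandardFilling_extendFilling {n : ℕ} {μ ν : YoungDiagram} (hμ : μ.card = n + 1)
    (hν : ν.card = n) (hle : ν ≤ μ) {F : ℕ × ℕ → ℕ}
    (hF : IsStandardFilling n (ν : Set (ℕ × ℕ)) F) :
    IsStandardFilling (n + 1) (μ : Set (ℕ × ℕ)) (extendFilling n μ ν F) := by
  obtain ⟨x, hx'⟩ := exists_mem_notMem_iff (hμ.trans (by rw [hν])) hle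
  have hval : ∀ p ∈ ν, extendFilling n μ ν F p = F p := fun p hp =>
    if_neg fun h => h.2 hp
  have hvalx : extendFilling n μ ν F x = n := if_pos ((hx' x).2 rfl)
  have hxν : x ∉ ν := ((hx' x).2 rfl).2
  have hxμ : x ∈ μ := ((hx' x).2 rfl).1
  have hlt : ∀ p ∈ ν, F p < n := fun p hp => hF.2.1.mapsTo hp
  have hins : (μ : Set (ℕ × ℕ)) = insert x (ν : Set (ℕ × ℕ)) := by
    ext p
    simp only [Set.mem_insert_iff, SetLike.mem_coe, ← hx']
    have := @hle p
    tauto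
  have hmono : ∀ p q : ℕ × ℕ, p ≤ q → p ≠ q → (q ∈ ν → F p < F q) → q ∈ μ →
      extendFilling n μ ν F p < extendFilling n μ ν F q := by
    intro p q hpq hne hFpq hq
    by_cases hqν : q ∈ ν
    · rw [hval q hqν, hval p (ν.isLowerSet hpq hqν)]
      exact hFpq hqν
    · obtain rfl := (hx' q).1 ⟨hq, hqν⟩
      have hp : p ∈ ν := by
        by_contra hp
        exact hne ((hx' p).1 ⟨μ.isLowerSet hpq hq, hp⟩)
      rw [hvalx, hval p hp]
      exact hlt p hp
  refine ⟨fun p hp => ?_, ?_, fun r c h => ?_, fun r c h => ?_⟩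
  · rw [extendFilling, if_neg fun h => hp h.1]
    exact hF.1 p fun h => hp (hle h)
  · have hIio : Set.Iio (n + 1) = insert n (Set.Iio n) := by
      ext a
      simp only [Set.mem_Iio, Set.mem_insert_iff]
      omega
    rw [hins, hIio]
    have h := (hF.2.1.congr fun p hp => (hval p hp).symm).insert (a := x)
    rw [hvalx] at h
    exact h (by simp)
  · exact hmono _ _ (Prod.mk_le_mk.2 ⟨le_rfl, Nat.le_succ c⟩) (by simp) (hF.2.2.1 r c) h
  · exact hmono _ _ (Prod.mk_le_mk.2 ⟨Nat.le_succ r, le_rfl⟩) (by simp) (hF.2.2.2 r c) h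

theorem mem_iff_extendFilling_lt {n : ℕ} {μ ν : YoungDiagram} (hle : ν ≤ μ) {F : ℕ × ℕ → ℕ}
    (hF : IsStandardFilling n (ν : Set (ℕ × ℕ)) F) (p : ℕ × ℕ) :
    p ∈ ν ↔ p ∈ μ ∧ extendFilling n μ ν F p < n := by
  by_cases hp : p ∈ ν
  · have : F p < n := hF.2.1.mapsTo hp
    simpa [hp, hle hp, extendFilling] using this
  · simp +contextual [hp, extendFilling]

theorem exists_extendFilling_eq {n : ℕ} {μ : YoungDiagram} {G : ℕ × ℕ → ℕ}
    (hG : IsStandardFilling (n + 1) (μ : Set (ℕ × ℕ)) G) :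
    ∃ ν : YoungDiagram, ν.card = n ∧ ν ≤ μ ∧
      ∃ F, IsStandardFilling n (ν : Set (ℕ × ℕ)) F ∧ extendFilling n μ ν F = G := by
  let ν : YoungDiagram := ⟨μ.cells.filter fun p => G p < n, by
    intro q p hpq hq
    simp only [coe_filter, Set.mem_ofPred_eq, mem_cells] at hq ⊢
    exact ⟨μ.isLowerSet hpq hq.1, (hG.le hpq hq.1).trans_lt hq.2⟩⟩
  have hν : ∀ p, p ∈ ν ↔ p ∈ μ ∧ G p < n := fun p =>
    (mem_filter : p ∈ μ.cells.filter (fun p => G p < n) ↔ _)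
  have hbij : Set.BijOn G (ν : Set (ℕ × ℕ)) (Set.Iio n) := by
    refine ⟨fun p hp => ((hν p).1 hp).2, hG.2.1.injOn.mono fun p hp => ((hν p).1 hp).1, ?_⟩
    intro a ha
    obtain ⟨p, hp, rfl⟩ := hG.2.1.surjOn (Nat.lt_succ_of_lt ha)
    exact ⟨p, (hν p).2 ⟨hp, ha⟩, rfl⟩
  have hval : ∀ p ∈ ν, (if p ∈ ν then G p else 0) = G p := fun p hp => if_pos hp
  refine ⟨ν, ?_, fun p hp => ((hν p).1 hp).1, fun p => if p ∈ ν then G p else 0, ⟨?_, ?_, ?_, ?_⟩, ?_⟩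
  · have h : ν.cells.image G = range n := by
      rw [← coe_inj, coe_image, coe_range]
      exact hbij.image_eq
    rw [YoungDiagram.card, ← card_image_of_injOn hbij.injOn, h, card_range]
  · exact fun p hp => if_neg hp
  · exact hbij.congr fun p hp => (hval p hp).symm
  · intro r c h
    beta_reduce
    rw [hval _ h, hval _ (ν.up_left_mem le_rfl (Nat.le_succ c) h)]
    exact hG.2.2.1 r c ((hν _).1 h).1
  · intro r c h
    beta_reduce
    rw [hval _ h, hval _ (ν.up_left_mem (Nat.le_succ r) le_rfl h)]
    exact hG.2.2.2 r c ((hν _).1 h).1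
  · funext p
    by_cases hp : p ∈ μ
    · by_cases hpν : p ∈ ν
      · simp [extendFilling, hpν]
      · have h1 : G p < n + 1 := hG.2.1.mapsTo hp
        have h2 : ¬ G p < n := fun h => hpν ((hν p).2 ⟨hp, h⟩)
        simp only [extendFilling, hp, hpν, not_false_eq_true, and_self, if_true]
        omega
    · have hpν : p ∉ ν := fun h => hp ((hν p).1 h).1
      simp [extendFilling, hp, hpν, hG.1 p hp]

open Classical in
theorem numTableaux_eq_sum {n : ℕ} {μ : YoungDiagram} (hμ : μ.card = n + 1) :
    μ.numTableaux = ∑ ν ∈ diagrams n with ν ≤ μ, ν.numTableaux := by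
  let f : (Σ ν : {ν // ν ∈ (diagrams n).filter (· ≤ μ)},
      {F // IsStandardFilling n (ν.1 : Set (ℕ × ℕ)) F}) →
      {F // IsStandardFilling (n + 1) (μ : Set (ℕ × ℕ)) F} := fun x =>
    ⟨extendFilling n μ x.1.1 x.2.1, isStandardFilling_extendFilling hμ
      (mem_diagrams.1 (mem_filter.1 x.1.2).1) (mem_filter.1 x.1.2).2 x.2.2⟩
  have hf : Function.Bijective f := by
    refine ⟨?_, fun G => ?_⟩
    · rintro ⟨⟨ν, hν⟩, F, hF⟩ ⟨⟨ν', hν'⟩, F', hF'⟩ h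
      have h : extendFilling n μ ν F = extendFilling n μ ν' F' := congrArg Subtype.val h
      have hνν' : ν = ν' := by
        refine SetLike.ext fun p => ?_
        rw [mem_iff_extendFilling_lt (mem_filter.1 hν).2 hF, h,
          mem_iff_extendFilling_lt (mem_filter.1 hν').2 hF']
      subst hνν'
      have hFF' : F = F' := hF.ext hF' fun p hp => by
        have hp' : ¬ (p ∈ μ ∧ p ∉ ν) := fun h => h.2 hp
        have := congrFun h p
        rwa [extendFilling, extendFilling, if_neg hp', if_neg hp'] at this
      subst hFF'
      rfl
    · obtain ⟨ν, hν, hle, F, hF, h⟩ := exists_extendFilling_eq G.2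
      exact ⟨⟨⟨ν, mem_filter.2 ⟨mem_diagrams.2 hν, hle⟩⟩, F, hF⟩, Subtype.ext h⟩
  rw [numTableaux, hμ, ← Nat.card_congr (Equiv.ofBijective f hf), Nat.card_sigma,
    ← sum_coe_sort ((diagrams n).filter (· ≤ μ))]
  refine sum_congr rfl fun ν _ => ?_
  rw [numTableaux, mem_diagrams.1 (mem_filter.1 ν.2).1]

theorem eq_of_le_of_card_le {μ ν : YoungDiagram} (hle : μ ≤ ν) (h : ν.card ≤ μ.card) : μ = ν :=
  YoungDiagram.ext (Finset.eq_of_subset_of_card_le (cells_subset_iff.2 hle) h)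

/-- The rows of `μ` whose last cell can be removed. -/
def removableRows (μ : YoungDiagram) : Finset ℕ :=
  {r ∈ range (μ.colLen 0) | μ.rowLen (r + 1) < μ.rowLen r}

theorem mem_removableRows {μ : YoungDiagram} {r : ℕ} :
    r ∈ μ.removableRows ↔ μ.rowLen (r + 1) < μ.rowLen r := by
  rw [removableRows, mem_filter, mem_range, ← mem_iff_lt_colLen, mem_iff_lt_rowLen]
  omega

/-- The rows of `μ` to which a cell can be added. -/
def addableRows (μ : YoungDiagram) : Finset ℕ :=
  insert 0 (μ.removableRows.image Nat.succ)

theorem mem_addableRows {μ : YoungDiagram} {r : ℕ} :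
    r ∈ μ.addableRows ↔ ∀ s < r, μ.rowLen r < μ.rowLen s := by
  rw [addableRows, mem_insert, mem_image]
  constructor
  · rintro (rfl | ⟨t, ht, rfl⟩) s hs
    · exact absurd hs (Nat.not_lt_zero s)
    · exact (mem_removableRows.1 ht).trans_le (μ.rowLen_anti s t (Nat.le_of_lt_succ hs))
  · intro h
    cases r with
    | zero => exact Or.inl rfl
    | succ t => exact Or.inr ⟨t, mem_removableRows.2 (h t (Nat.lt_succ_self t)), rfl⟩

theorem card_addableRows (μ : YoungDiagram) :
    μ.addableRows.card = μ.removableRows.card + 1 := by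
  rw [addableRows, card_insert_of_notMem (by simp), card_image_of_injective _ Nat.succ_injective]

/-- Add a cell at the end of an addable row. -/
def addCell (μ : YoungDiagram) (r : ℕ) (hr : r ∈ μ.addableRows) : YoungDiagram where
  cells := insert (r, μ.rowLen r) μ.cells
  isLowerSet := by
    rintro ⟨i, j⟩ ⟨i', j'⟩ hle h
    obtain ⟨hi, hj⟩ := Prod.mk_le_mk.1 hle
    rw [mem_coe, mem_insert, mem_cells] at h ⊢
    rcases h with h | h
    · obtain ⟨rfl, rfl⟩ := Prod.mk.inj h
      rcases hi.lt_or_eq with hi | rfl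
      · exact Or.inr (mem_iff_lt_rowLen.2 (hj.trans_lt (mem_addableRows.1 hr i' hi)))
      · rcases hj.lt_or_eq with hj | rfl
        · exact Or.inr (mem_iff_lt_rowLen.2 hj)
        · exact Or.inl rfl
    · exact Or.inr (μ.up_left_mem hi hj h)

/-- Remove the last cell of a removable row. -/
def removeCell (μ : YoungDiagram) (r : ℕ) (hr : r ∈ μ.removableRows) : YoungDiagram where
  cells := μ.cells.erase (r, μ.rowLen r - 1)
  isLowerSet := by
    rintro ⟨i, j⟩ ⟨i', j'⟩ hle h
    obtain ⟨hi, hj⟩ := Prod.mk_le_mk.1 hle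
    have hr := mem_removableRows.1 hr
    rw [mem_coe, mem_erase, mem_cells] at h ⊢
    refine ⟨fun h' => h.1 ?_, μ.up_left_mem hi hj h.2⟩
    obtain ⟨rfl, rfl⟩ := Prod.mk.inj h'
    have hij := mem_iff_lt_rowLen.1 h.2
    rcases hi.lt_or_eq with hi | rfl
    · have := μ.rowLen_anti (i' + 1) i hi
      omega
    · exact Prod.ext rfl (by simp only; omega)

theorem end_notMem (μ : YoungDiagram) (r : ℕ) : (r, μ.rowLen r) ∉ μ := by
  simp [mem_iff_lt_rowLen]

theorem end_mem {μ : YoungDiagram} {r : ℕ} (hr : r ∈ μ.removableRows) :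
    (r, μ.rowLen r - 1) ∈ μ := by
  rw [mem_removableRows] at hr
  rw [mem_iff_lt_rowLen]
  omega

open Classical in
theorem card_filter_ge_eq_card_addableRows (μ : YoungDiagram) :
    #{lam ∈ diagrams (μ.card + 1) | μ ≤ lam} = #μ.addableRows := by
  symm
  refine card_bij (fun r hr => μ.addCell r hr) (fun r hr => ?_) (fun r hr s hs h => ?_)
    (fun lam hlam => ?_)
  · refine mem_filter.2 ⟨mem_diagrams.2 (card_insert_of_notMem (μ.end_notMem r)), ?_⟩
    exact cells_subset_iff.1 (subset_insert _ _)
  · have hmem : (r, μ.rowLen r) ∈ (μ.addCell s hs).cells := by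
      rw [← h]
      exact mem_insert_self _ _
    rcases mem_insert.1 hmem with h' | h'
    · exact congrArg Prod.fst h'
    · exact absurd h' (μ.end_notMem r)
  · obtain ⟨hcard, hle⟩ := mem_filter.1 hlam
    obtain ⟨⟨r, c⟩, hx⟩ := exists_mem_notMem_iff (mem_diagrams.1 hcard) hle
    obtain ⟨hl, hm⟩ := (hx (r, c)).2 rfl
    have hc : μ.rowLen r = c := by
      rw [mem_iff_lt_rowLen, not_lt] at hm
      exact congrArg Prod.snd ((hx _).1 ⟨lam.up_left_mem le_rfl hm hl, μ.end_notMem r⟩)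
    subst hc
    have hr : r ∈ μ.addableRows := by
      refine mem_addableRows.2 fun s hs => ?_
      rw [← mem_iff_lt_rowLen]
      by_contra h
      have := congrArg Prod.fst ((hx _).1 ⟨lam.up_left_mem hs.le le_rfl hl, h⟩)
      exact hs.ne this
    refine ⟨r, hr, eq_of_le_of_card_le ?_ ?_⟩
    · rw [← cells_subset_iff]
      exact insert_subset hl hle
    · rw [mem_diagrams.1 hcard]
      exact (card_insert_of_notMem (μ.end_notMem r)).ge

open Classical in
theorem card_filter_le_eq_card_removableRows {n : ℕ} {μ : YoungDiagram} (hμ : μ.card = n + 1) :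
    #{κ ∈ diagrams n | κ ≤ μ} = #μ.removableRows := by
  symm
  have hcard : ∀ r (hr : r ∈ μ.removableRows), (μ.removeCell r hr).card = n := fun r hr => by
    have h : (μ.removeCell r hr).card = μ.card - 1 := card_erase_of_mem (end_mem hr)
    omega
  refine card_bij (fun r hr => μ.removeCell r hr) (fun r hr => ?_) (fun r hr s hs h => ?_)
    (fun κ hκ => ?_)
  · refine mem_filter.2 ⟨mem_diagrams.2 (hcard r hr), ?_⟩
    exact cells_subset_iff.1 (erase_subset _ _)
  · have hmem : (r, μ.rowLen r - 1) ∉ (μ.removeCell s hs).cells := by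
      rw [← h]
      exact notMem_erase _ _
    by_contra hne
    exact hmem (mem_erase.2 ⟨fun h' => hne (congrArg Prod.fst h'), end_mem hr⟩)
  · obtain ⟨hκn, hle⟩ := mem_filter.1 hκ
    have hκn := mem_diagrams.1 hκn
    obtain ⟨⟨r, c⟩, hx⟩ := exists_mem_notMem_iff (hμ.trans (by rw [hκn])) hle
    obtain ⟨hl, hm⟩ := (hx (r, c)).2 rfl
    have hlast : ∀ d, c ≤ d → (r, d) ∈ μ → d = c := fun d hd h =>
      congrArg Prod.snd ((hx (r, d)).1 ⟨h, fun h' => hm (κ.up_left_mem le_rfl hd h')⟩)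
    have hlen : μ.rowLen r = c + 1 := by
      have h1 := mem_iff_lt_rowLen.1 hl
      by_contra h
      have := hlast (c + 1) (Nat.le_succ c) (mem_iff_lt_rowLen.2 (by omega))
      omega
    have hr : r ∈ μ.removableRows := by
      rw [mem_removableRows, hlen, Nat.lt_succ_iff, ← not_lt, ← mem_iff_lt_rowLen]
      intro h
      have := congrArg Prod.fst ((hx _).1 ⟨h, fun h' => hm (κ.up_left_mem (Nat.le_succ r) le_rfl h')⟩)
      exact (Nat.succ_ne_self r) this
    refine ⟨r, hr, (eq_of_le_of_card_le ?_ ?_).symm⟩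
    · rw [← cells_subset_iff]
      refine subset_erase.2 ⟨hle, ?_⟩
      rw [hlen]
      exact hm
    · rw [hκn, hcard r hr]

open Classical in
theorem card_filter_ge_of_le_card {n : ℕ} {μ : YoungDiagram} (h : n ≤ μ.card) :
    #{lam ∈ diagrams n | μ ≤ lam} = if μ.card = n then 1 else 0 := by
  have heq : ∀ lam ∈ diagrams n, μ ≤ lam → μ = lam := fun lam hlam hle =>
    eq_of_le_of_card_le hle ((mem_diagrams.1 hlam).trans_le h)
  split_ifs with hn
  · rw [card_eq_one]
    refine ⟨μ, eq_singleton_iff_unique_mem.2 ⟨mem_filter.2 ⟨mem_diagrams.2 hn, le_rfl⟩, ?_⟩⟩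
    intro lam hlam
    exact (heq lam (mem_filter.1 hlam).1 (mem_filter.1 hlam).2).symm
  · rw [card_eq_zero, filter_eq_empty_iff]
    intro lam hlam hle
    exact hn (heq lam hlam hle ▸ mem_diagrams.1 hlam)

open Classical in
theorem card_filter_le_of_card_le {n : ℕ} {μ : YoungDiagram} (h : μ.card ≤ n) :
    #{κ ∈ diagrams n | κ ≤ μ} = if μ.card = n then 1 else 0 := by
  have heq : ∀ κ ∈ diagrams n, κ ≤ μ → κ = μ := fun κ hκ hle =>
    eq_of_le_of_card_le hle (h.trans_eq (mem_diagrams.1 hκ).symm)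
  split_ifs with hn
  · rw [card_eq_one]
    refine ⟨μ, eq_singleton_iff_unique_mem.2 ⟨mem_filter.2 ⟨mem_diagrams.2 hn, le_rfl⟩, ?_⟩⟩
    intro κ hκ
    exact heq κ (mem_filter.1 hκ).1 (mem_filter.1 hκ).2
  · rw [card_eq_zero, filter_eq_empty_iff]
    intro κ hκ hle
    exact hn (heq κ hκ hle ▸ mem_diagrams.1 hκ)

open Classical in
/-- Young's lattice is a differential poset. -/
theorem card_upper_covers_eq_card_lower_covers {n : ℕ} {μ ν : YoungDiagram} (hμ : μ.card = n + 1)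
    (hν : ν.card = n + 1) :
    #{lam ∈ diagrams (n + 2) | μ ≤ lam ∧ ν ≤ lam} =
      #{κ ∈ diagrams n | κ ≤ μ ∧ κ ≤ ν} + if μ = ν then 1 else 0 := by
  by_cases h : μ = ν
  · subst h
    simp only [and_self, if_true]
    rw [card_filter_le_eq_card_removableRows hμ, ← card_addableRows,
      ← card_filter_ge_eq_card_addableRows, hμ]
  · have hadd : (μ ⊔ ν).card + (μ ⊓ ν).card = μ.card + ν.card :=
      card_union_add_card_inter μ.cells ν.cells
    have hsup : n + 2 ≤ (μ ⊔ ν).card := by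
      by_contra hlt
      have h1 : μ = μ ⊔ ν := eq_of_le_of_card_le le_sup_left (by omega)
      have h2 : ν = μ ⊔ ν := eq_of_le_of_card_le le_sup_right (by omega)
      exact h (h1.trans h2.symm)
    simp only [← sup_le_iff, ← le_inf_iff, if_neg h, add_zero]
    rw [card_filter_ge_of_le_card hsup, card_filter_le_of_card_le (by omega)]
    exact if_congr (by omega) rfl rfl

theorem diagrams_zero : diagrams 0 = {⊥} := by
  refine eq_singleton_iff_unique_mem.2 ⟨mem_diagrams.2 card_empty, fun μ hμ => ?_⟩
  exact YoungDiagram.ext (card_eq_zero.1 (mem_diagrams.1 hμ))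

theorem numTableaux_bot : numTableaux ⊥ = 1 := by
  have h0 : IsStandardFilling 0 ((⊥ : YoungDiagram) : Set (ℕ × ℕ)) (fun _ => 0) := by
    refine ⟨fun _ _ => rfl, ?_, fun r c h => absurd h (notMem_bot _),
      fun r c h => absurd h (notMem_bot _)⟩
    rw [coe_bot, show Set.Iio 0 = (∅ : Set ℕ) by ext; simp]
    exact Set.bijOn_empty _
  rw [numTableaux, Nat.card_eq_one_iff_unique]
  refine ⟨⟨fun F G => Subtype.ext (F.2.ext G.2 fun p hp => absurd hp (notMem_bot _))⟩, ⟨⟨_, h0⟩⟩⟩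

open Classical in
theorem sum_filter_sum_filter {n m : ℕ} (f : YoungDiagram → ℕ)
    (p q : YoungDiagram → YoungDiagram → Prop) (μ : YoungDiagram) :
    ∑ lam ∈ diagrams m with p μ lam, ∑ ν ∈ diagrams n with q ν lam, f ν =
      ∑ ν ∈ diagrams n, #{lam ∈ diagrams m | p μ lam ∧ q ν lam} * f ν := by
  simp_rw [sum_filter (s := diagrams n)]
  rw [sum_comm]
  refine sum_congr rfl fun ν _ => ?_
  rw [← sum_filter, filter_filter, sum_const, smul_eq_mul]

open Classical in
theorem sum_numTableaux_ge {n : ℕ} {μ : YoungDiagram} (hμ : μ.card = n) :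
    ∑ lam ∈ diagrams (n + 1) with μ ≤ lam, lam.numTableaux = (n + 1) * μ.numTableaux := by
  have hstep : ∀ m (μ : YoungDiagram), ∑ lam ∈ diagrams (m + 1) with μ ≤ lam, lam.numTableaux =
      ∑ ν ∈ diagrams m, #{lam ∈ diagrams (m + 1) | μ ≤ lam ∧ ν ≤ lam} * ν.numTableaux := by
    intro m μ
    rw [← sum_filter_sum_filter _ (fun a b => a ≤ b) (fun a b => a ≤ b)]
    exact sum_congr rfl fun lam hlam =>
      numTableaux_eq_sum (mem_diagrams.1 (mem_filter.1 hlam).1)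
  induction n generalizing μ with
  | zero =>
    obtain rfl : μ = ⊥ := by
      rw [← mem_singleton, ← diagrams_zero]
      exact mem_diagrams.2 hμ
    have hcard : #{lam ∈ diagrams (0 + 1) | ⊥ ≤ lam} = #(addableRows ⊥) :=
      card_filter_ge_eq_card_addableRows ⊥
    rw [card_addableRows, show removableRows ⊥ = ∅ by
      ext r
      have : ¬ 0 < (⊥ : YoungDiagram).rowLen r := by
        rw [← mem_iff_lt_rowLen]
        exact notMem_bot _
      simp only [mem_removableRows, notMem_empty, iff_false]
      omega] at hcard
    rw [hstep, diagrams_zero, sum_singleton, numTableaux_bot]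
    simpa using hcard
  | succ n ih =>
    rw [hstep]
    have h : ∀ ν ∈ diagrams (n + 1),
        #{lam ∈ diagrams (n + 1 + 1) | μ ≤ lam ∧ ν ≤ lam} * ν.numTableaux =
          #{κ ∈ diagrams n | κ ≤ μ ∧ κ ≤ ν} * ν.numTableaux +
            if μ = ν then ν.numTableaux else 0 := fun ν hν => by
      rw [card_upper_covers_eq_card_lower_covers hμ (mem_diagrams.1 hν), add_mul]
      split_ifs <;> simp
    rw [sum_congr rfl h, sum_add_distrib, sum_ite_eq, if_pos (mem_diagrams.2 hμ),
      ← sum_filter_sum_filter _ (fun a b => b ≤ a) (fun a b => b ≤ a),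
      sum_congr rfl fun κ hκ => ih (mem_diagrams.1 (mem_filter.1 hκ).1), ← mul_sum,
      ← numTableaux_eq_sum hμ]
    ring

theorem sum_numTableaux_sq (n : ℕ) : ∑ μ ∈ diagrams n, μ.numTableaux ^ 2 = n.factorial := by
  classical
  induction n with
  | zero => simp [diagrams_zero, numTableaux_bot]
  | succ n ih =>
    calc ∑ μ ∈ diagrams (n + 1), μ.numTableaux ^ 2
        = ∑ μ ∈ diagrams (n + 1), ∑ ν ∈ diagrams n,
            if ν ≤ μ then ν.numTableaux * μ.numTableaux else 0 := by
          refine sum_congr rfl fun μ hμ => ?_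
          rw [sq, ← sum_filter, ← sum_mul, ← numTableaux_eq_sum (mem_diagrams.1 hμ)]
      _ = ∑ ν ∈ diagrams n, (n + 1) * ν.numTableaux ^ 2 := by
          rw [sum_comm]
          refine sum_congr rfl fun ν hν => ?_
          rw [← sum_filter, ← mul_sum, sum_numTableaux_ge (mem_diagrams.1 hν)]
          ring
      _ = (n + 1).factorial := by rw [← mul_sum, ih, Nat.factorial_succ]

theorem sum_fSYT_sq (n : ℕ) : ∑ p : n.Partition, fSYT n p.parts ^ 2 = n.factorial := by
  simp only [← sum_numTableaux_sq, diagrams, sum_map, fSYT_parts, Function.Embedding.coeFn_mk]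

end YoungDiagram

end Tableaux

section SetPartitions

open Finset

instance finite_setoid (α : Type*) [Finite α] : Finite (Setoid α) :=
  Finite.of_injective (fun S => (S.r : α → α → Prop)) fun _ _ h =>
    Setoid.ext fun a b => iff_of_eq (congrFun (congrFun h a) b)

theorem card_setoid_eq_bell (α : Type*) [Finite α] : Nat.card (Setoid α) = bell (Nat.card α) := by
  let e := Finite.equivFin α
  exact Nat.card_congr ⟨fun S => S.comap e.symm, fun S => S.comap e,
    fun S => by ext; simp [Setoid.comap_rel], fun S => by ext; simp [Setoid.comap_rel]⟩

/-- A function is a kernel together with an injection from the quotient. -/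
theorem pow_eq_sum_stirling (n r : ℕ) :
    n ^ r = ∑ i ∈ range (r + 1), n.choose i * i.factorial * stirling r i := by
  classical
  let f : (Σ S : Setoid (Fin r), Quotient S ↪ Fin n) → (Fin r → Fin n) :=
    fun x a => x.2 (Quotient.mk x.1 a)
  have hf : Function.Bijective f := by
    refine ⟨?_, fun g => ?_⟩
    · rintro ⟨S, e⟩ ⟨S', e'⟩ h
      have hS : ∀ (S : Setoid (Fin r)) (e : Quotient S ↪ Fin n), S = Setoid.ker (f ⟨S, e⟩) := by
        intro S e
        ext a b
        rw [Setoid.ker_def, e.apply_eq_iff_eq, Quotient.eq]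
      obtain rfl : S = S' := by rw [hS S e, h, ← hS]
      obtain rfl : e = e' := by
        ext q
        induction q using Quotient.inductionOn with
        | h a => exact congrArg Fin.val (congrFun h a)
      rfl
    · exact ⟨⟨Setoid.ker g, ⟨Setoid.kerLift g, Setoid.kerLift_injective g⟩⟩, rfl⟩
  have : Fintype (Setoid (Fin r)) := Fintype.ofFinite _
  have hemb : ∀ S : Setoid (Fin r), Nat.card (Quotient S ↪ Fin n) =
      n.choose (Nat.card (Quotient S)) * (Nat.card (Quotient S)).factorial := fun S => by
    rw [Nat.card_eq_fintype_card, Fintype.card_embedding_eq, Fintype.card_fin,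
      Nat.card_eq_fintype_card, Nat.descFactorial_eq_factorial_mul_choose, mul_comm]
  have hle : ∀ S ∈ (univ : Finset (Setoid (Fin r))), Nat.card (Quotient S) ∈ range (r + 1) := by
    intro S _
    rw [mem_range, Nat.lt_succ_iff]
    simpa using Nat.card_le_card_of_surjective (Quotient.mk S) Quotient.mk_surjective
  calc n ^ r = Nat.card (Fin r → Fin n) := by simp
    _ = ∑ S : Setoid (Fin r), Nat.card (Quotient S ↪ Fin n) := by
      rw [← Nat.card_congr (Equiv.ofBijective f hf), Nat.card_sigma]
    _ = ∑ i ∈ range (r + 1), n.choose i * i.factorial * stirling r i := by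
      rw [← sum_fiberwise_of_maps_to hle]
      refine sum_congr rfl fun i _ => ?_
      rw [sum_congr rfl fun S hS => by rw [hemb, (mem_filter.1 hS).2], sum_const, smul_eq_mul,
        mul_comm, stirling, Nat.card_eq_fintype_card, Fintype.card_subtype]

/-- A map whose kernel is the set partition of `α ⊕ β` in which the elements of `α` lie in distinct parts,
`b ∈ T` lies in the part of `g b`, and the elements of `β` outside `T` are partitioned by `S`. -/
noncomputable def labelling {α β : Type*} (T : Finset β) (g : T → α)
    (S : Setoid {b // b ∉ T}) : α ⊕ β → α ⊕ Quotient S :=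
  open Classical in
  Sum.elim Sum.inl fun b => if h : b ∈ T then Sum.inl (g ⟨b, h⟩) else Sum.inr (Quotient.mk S ⟨b, h⟩)

section labelling

variable {α β : Type*} {T : Finset β} {g : T → α} {S : Setoid {b // b ∉ T}}

theorem labelling_inl (a : α) : labelling T g S (Sum.inl a) = Sum.inl a := rfl

theorem labelling_of_mem {b : β} (h : b ∈ T) :
    labelling T g S (Sum.inr b) = Sum.inl (g ⟨b, h⟩) := dif_pos h

theorem labelling_of_notMem {b : β} (h : b ∉ T) :
    labelling T g S (Sum.inr b) = Sum.inr (Quotient.mk S ⟨b, h⟩) := dif_neg h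

theorem ker_labelling_inl_inr {a : α} {b : β} :
    Setoid.ker (labelling T g S) (Sum.inl a) (Sum.inr b) ↔ ∃ h : b ∈ T, g ⟨b, h⟩ = a := by
  rw [Setoid.ker_def, labelling_inl]
  by_cases h : b ∈ T
  · simp [labelling_of_mem h, h, eq_comm]
  · simp [labelling_of_notMem h, h]

theorem ker_labelling_inr_inr {b c : {b // b ∉ T}} :
    Setoid.ker (labelling T g S) (Sum.inr b.1) (Sum.inr c.1) ↔ S b c := by
  rw [Setoid.ker_def, labelling_of_notMem b.2, labelling_of_notMem c.2, Sum.inr.injEq, Quotient.eq]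

end labelling

theorem card_restricted_sum (α β : Type*) [Finite α] [Fintype β] :
    Nat.card {P : Setoid (α ⊕ β) // ∀ a b : α, P (Sum.inl a) (Sum.inl b) → a = b} =
      ∑ T : Finset β, Nat.card α ^ #T * bell (Fintype.card β - #T) := by
  classical
  let f : (Σ T : Finset β, (T → α) × Setoid {b // b ∉ T}) →
      {P : Setoid (α ⊕ β) // ∀ a b : α, P (Sum.inl a) (Sum.inl b) → a = b} := fun x =>
    ⟨Setoid.ker (labelling x.1 x.2.1 x.2.2), fun a b h => Sum.inl_injective h⟩
  have hf : Function.Bijective f := by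
    refine ⟨?_, ?_⟩
    · rintro ⟨T, g, S⟩ ⟨T', g', S'⟩ h
      have h : Setoid.ker (labelling T g S) = Setoid.ker (labelling T' g' S') :=
        congrArg Subtype.val h
      have key : ∀ a b, (∃ h : b ∈ T, g ⟨b, h⟩ = a) ↔ ∃ h : b ∈ T', g' ⟨b, h⟩ = a := fun a b => by
        rw [← ker_labelling_inl_inr (S := S), h, ker_labelling_inl_inr]
      obtain rfl : T = T' := by
        ext b
        exact ⟨fun hb => ((key _ b).1 ⟨hb, rfl⟩).1, fun hb => ((key _ b).2 ⟨hb, rfl⟩).1⟩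
      obtain rfl : g = g' := by
        funext b
        exact ((key _ b).1 ⟨b.2, rfl⟩).2.symm
      obtain rfl : S = S' := by
        ext b c
        rw [← ker_labelling_inr_inr (g := g), h, ker_labelling_inr_inr]
      rfl
    · rintro ⟨P, hP⟩
      let T : Finset β := {b | ∃ a, P (Sum.inl a) (Sum.inr b)}
      have hT : ∀ b, b ∈ T ↔ ∃ a, P (Sum.inl a) (Sum.inr b) := fun b => by simp [T]
      choose g hg using fun b : T => (hT b.1).1 b.2
      have hg' : ∀ a b, (∃ h : b ∈ T, g ⟨b, h⟩ = a) ↔ P (Sum.inl a) (Sum.inr b) := by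
        intro a b
        constructor
        · rintro ⟨h, rfl⟩
          exact hg ⟨b, h⟩
        · intro h
          have hb := (hT b).2 ⟨a, h⟩
          exact ⟨hb, hP _ _ (P.trans (hg ⟨b, hb⟩) (P.symm h))⟩
      refine ⟨⟨T, g, P.comap fun b => Sum.inr b.1⟩, Subtype.ext (Setoid.ext ?_)⟩
      rintro (a | b) (c | d)
      · exact ⟨fun h => Sum.inl_injective h ▸ P.refl _, fun h => hP _ _ h ▸ rfl⟩
      · exact ker_labelling_inl_inr.trans (hg' a d)
      · exact (Setoid.comm' _).trans ((ker_labelling_inl_inr.trans (hg' c b)).trans (Setoid.comm' _))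
      · by_cases hb : b ∈ T
        · have h1 := hg ⟨b, hb⟩
          have h2 : labelling T g (P.comap fun b => Sum.inr b.1) (Sum.inr b) =
            labelling T g (P.comap fun b => Sum.inr b.1) (Sum.inl (g ⟨b, hb⟩)) := labelling_of_mem hb
          refine (Eq.congr_left h2).trans (ker_labelling_inl_inr.trans ((hg' _ _).trans ?_))
          exact ⟨fun h => P.trans (P.symm h1) h, fun h => P.trans h1 h⟩
        · by_cases hd : d ∈ T
          · have h1 := hg ⟨d, hd⟩
            have hnot : ¬ P (Sum.inr b) (Sum.inr d) := fun h =>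
              hb ((hT b).2 ⟨_, P.trans h1 (P.symm h)⟩)
            refine iff_of_false (fun h => ?_) hnot
            change labelling _ _ _ _ = labelling _ _ _ _ at h
            rw [labelling_of_mem hd, labelling_of_notMem hb] at h
            cases h
          · exact ker_labelling_inr_inr (b := ⟨b, hb⟩) (c := ⟨d, hd⟩)
  rw [← Nat.card_congr (Equiv.ofBijective f hf), Nat.card_sigma]
  refine sum_congr rfl fun T _ => ?_
  rw [Nat.card_prod, Nat.card_fun, card_setoid_eq_bell]
  simp [Fintype.card_subtype_compl]

theorem card_restricted_eq_sum_pow (n k : ℕ) :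
    Nat.card {P : Setoid (Fin (n + k)) // Restricted n k P} =
      ∑ r ∈ range (k + 1), k.choose r * (n ^ r * bell (k - r)) := by
  have h := card_restricted_sum (Fin n) (Fin k)
  rw [← powerset_univ] at h
  simp only [Nat.card_fin, Fintype.card_fin] at h
  rw [sum_powerset_apply_card (fun r => n ^ r * bell (k - r)), card_univ, Fintype.card_fin] at h
  simp only [smul_eq_mul] at h
  rw [← h]
  refine Nat.card_congr ⟨fun P => ⟨P.1.comap finSumFinEquiv, fun a b hab => P.2 a b hab⟩,
    fun P => ⟨P.1.comap finSumFinEquiv.symm, fun a b hab => P.2 a b ?_⟩, fun P => ?_, fun P => ?_⟩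
  · change P.1 (finSumFinEquiv.symm _) (finSumFinEquiv.symm _) at hab
    simpa using hab
  · ext; simp [Setoid.comap_rel]
  · ext; simp [Setoid.comap_rel]

end SetPartitions

/-- For `n ≥ k`, the number of `n`-restricted set partitions of `{1,…,n+k}`
equals `∑_{λ ⊢ i, 0 ≤ i ≤ k} ∑_{r=i}^{k} C(n,i)·C(k,r)·S(r,i)·B(k-r)·(f^λ)²`. -/
theorem card_restricted_partitions (n k : ℕ) (hkn : k ≤ n) :
    Nat.card {P : Setoid (Fin (n + k)) // Restricted n k P} =
      ∑ i ∈ Finset.range (k + 1), ∑ p : Nat.Partition i, ∑ r ∈ Finset.Icc i k,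
        n.choose i * k.choose r * stirling r i * bell (k - r) *
          (fSYT i p.parts) ^ 2 := by
  rw [card_restricted_eq_sum_pow]
  have h : ∀ i, ∑ p : Nat.Partition i, ∑ r ∈ Finset.Icc i k,
      n.choose i * k.choose r * stirling r i * bell (k - r) * (fSYT i p.parts) ^ 2 =
      ∑ r ∈ Finset.Icc i k,
        k.choose r * (n.choose i * i.factorial * stirling r i * bell (k - r)) := fun i => by
    rw [Finset.sum_comm]
    refine Finset.sum_congr rfl fun r _ => ?_
    rw [← Finset.mul_sum, YoungDiagram.sum_fSYT_sq]
    ring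
  simp_rw [h]
  rw [Finset.sum_comm' (t' := Finset.range (k + 1)) (s' := fun r => Finset.range (r + 1))]
  · refine Finset.sum_congr rfl fun r _ => ?_
    rw [← Finset.mul_sum, ← Finset.sum_mul, ← pow_eq_sum_stirling]
  · intro i r
    simp only [Finset.mem_range, Finset.mem_Icc]
    omega
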